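/- arXiv:1712.03583 — 2 statements merged into one kernel-verified Lean document; each statement's English description precedes it below -/
import Mathlib

section
/- Let C ⊆ ℝ^n be a nonempty convex compact set, f : C × C → ℝ an equilibrium bifunction, K : C ⇉ C lower semicontinuous with nonempty convex values and fix K closed, and F(x) := {y ∈ C : f(x,y) < 0}. Assume: (i) F(x) is convex for every x ∈ fix K; (ii) F is lower semicontinuous at every point of fix K; (iii) the affine hull of K(x) equals the affine hull of C for every x ∈ ∂_C fix K; (iv) F(x) is open in the relative topology of C for every x ∈ ∂_C fix K. Then the quasiequilibrium problem has a solution: there exists x ∈ K(x) with f(x,y) ≥ 0 for all y ∈ K(x). -/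
open Set Topology Filter

/-- A set-valued map `Φ : X ⇉ Y` is lower semicontinuous at `x` if for every open set `Ω`
with `Φ x ∩ Ω ≠ ∅` there is a neighborhood of `x` on which `Φ x' ∩ Ω ≠ ∅`. -/
def LscAt {X Y : Type*} [TopologicalSpace X] [TopologicalSpace Y]
    (Φ : X → Set Y) (x : X) : Prop :=
  ∀ Ω : Set Y, IsOpen Ω → (Φ x ∩ Ω).Nonempty → ∀ᶠ x' in 𝓝 x, (Φ x' ∩ Ω).Nonempty

section NoRetraction

open MeasureTheory

variable {E : Type*} [NormedAddCommGroup E]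

theorem exists_polynomial_det_one_add_smul [NormedSpace ℝ E] [FiniteDimensional ℝ E]
    (A : E →L[ℝ] E) :
    ∃ p : Polynomial ℝ, p.degree < (Module.finrank ℝ E + 1 : ℕ) ∧
      ∀ t : ℝ, p.eval t = (1 + t • A).det := by
  let b := Module.finBasis ℝ E
  let M := LinearMap.toMatrix b b A.toLinearMap
  refine ⟨((Polynomial.X : Polynomial ℝ) • M.map Polynomial.C
    + (1 : Matrix _ _ ℝ).map Polynomial.C).det, ?_, fun t => ?_⟩
  · rw [Polynomial.degree_lt_iff_coeff_zero]
    intro m hm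
    refine Polynomial.coeff_eq_zero_of_natDegree_lt ?_
    have := Polynomial.natDegree_det_X_add_C_le M 1
    simp only [Fintype.card_fin] at this
    omega
  · rw [← Polynomial.coe_evalRingHom, RingHom.map_det]
    have : (1 + t • A).det = (LinearMap.toMatrix b b (1 + t • A).toLinearMap).det :=
      (LinearMap.det_toMatrix b _).symm
    rw [this]
    congr 1
    ext i j
    simp [M, LinearMap.toMatrix_apply, Matrix.one_apply, add_comm, Finsupp.single_apply, eq_comm]
    split_ifs <;> simp [mul_comm]

theorem exists_polynomial_setIntegral_det [NormedSpace ℝ E] [FiniteDimensional ℝ E]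
    [MeasurableSpace E] (μ : Measure E) (s : Set E) (A : E → E →L[ℝ] E)
    (hA : ∀ t : ℝ, IntegrableOn (fun x => (1 + t • A x).det) s μ) :
    ∃ p : Polynomial ℝ, ∀ t : ℝ, p.eval t = ∫ x in s, (1 + t • A x).det ∂μ := by
  classical
  let N := Finset.range (Module.finrank ℝ E + 1)
  let v : ℕ → ℝ := fun i => i
  have hv : Set.InjOn v N := fun i _ j _ h => Nat.cast_injective (R := ℝ) h
  refine ⟨Lagrange.interpolate N v fun i => ∫ x in s, (1 + (i : ℝ) • A x).det ∂μ, fun t => ?_⟩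
  have key : ∀ x, (1 + t • A x).det
      = ∑ i ∈ N, (1 + (i : ℝ) • A x).det * (Lagrange.basis N v i).eval t := by
    intro x
    obtain ⟨p, hp, hpe⟩ := exists_polynomial_det_one_add_smul (A x)
    have h := Lagrange.eq_interpolate (f := p) hv (by simpa [N] using hp)
    rw [← hpe t, h, Lagrange.interpolate_apply, Polynomial.eval_finsetSum]
    simp [hpe, v]
  simp_rw [key]
  rw [integral_finsetSum N (f := fun (i : ℕ) x =>
    (1 + (i : ℝ) • A x).det * (Lagrange.basis N v i).eval t)
    fun i _ => (hA i).mul_const _]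
  simp_rw [integral_mul_const]
  rw [Lagrange.interpolate_apply, Polynomial.eval_finsetSum]
  simp

variable [InnerProductSpace ℝ E] [FiniteDimensional ℝ E]

open Metric

theorem exists_surjOn_perturbation {r : E → E}
    (hr : ∀ x ∈ closedBall (0 : E) 1, ContDiffAt ℝ 1 r x)
    (hsphere : ∀ x ∈ closedBall (0 : E) 1, ‖r x‖ = 1)
    (hid : ∀ x : E, ‖x‖ = 1 → r x = x) :
    ∃ δ : ℝ, 0 < δ ∧ ∀ t : ℝ, 0 < t → t < δ →
      InjOn (fun x => x + t • (r x - x)) (ball (0 : E) 1) ∧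
      (fun x => x + t • (r x - x)) '' ball (0 : E) 1 = ball 0 1 ∧
      ∀ x ∈ ball (0 : E) 1, 0 < (1 + t • fderiv ℝ (fun x => r x - x) x).det := by
  set g : E → E := fun x => r x - x with hg
  have hgc : ∀ x ∈ closedBall (0 : E) 1, ContDiffAt ℝ 1 g x := fun x hx =>
    (hr x hx).sub contDiffAt_id
  have hder : ContinuousOn (fderiv ℝ g) (closedBall 0 1) := fun x hx =>
    ((hgc x hx).fderiv_right (m := 0) (by norm_num)).continuousAt.continuousWithinAt
  obtain ⟨L, hL⟩ := (isCompact_closedBall (0 : E) 1).exists_bound_of_continuousOn hder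
  set M : ℝ := max L 1
  have hM : 0 < M := lt_of_lt_of_le one_pos (le_max_right _ _)
  have hLM : ∀ x ∈ closedBall (0 : E) 1, ‖fderiv ℝ g x‖ ≤ M := fun x hx =>
    (hL x hx).trans (le_max_left _ _)
  have hlip : ∀ x ∈ closedBall (0 : E) 1, ∀ y ∈ closedBall (0 : E) 1,
      ‖g y - g x‖ ≤ M * ‖y - x‖ := fun x hx y hy =>
    (convex_closedBall (0 : E) 1).norm_image_sub_le_of_norm_fderiv_le
      (fun z hz => (hgc z hz).differentiableAt (by norm_num)) hLM hx hy
  refine ⟨min 1 M⁻¹, by positivity, fun t ht0 ht => ?_⟩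
  have ht1 : t < 1 := ht.trans_le (min_le_left _ _)
  have htM : t * M < 1 := by
    have := ht.trans_le (min_le_right _ _)
    calc t * M < M⁻¹ * M := by gcongr
      _ = 1 := inv_mul_cancel₀ hM.ne'
  have hdetne : ∀ s : ℝ, 0 ≤ s → s ≤ t → ∀ x ∈ closedBall (0 : E) 1,
      IsUnit (1 + s • fderiv ℝ g x) := by
    intro s hs0 hst x hx
    have : IsUnit (1 - (-(s • fderiv ℝ g x))) := by
      apply isUnit_one_sub_of_norm_lt_one
      rw [norm_neg, norm_smul, Real.norm_of_nonneg hs0]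
      calc s * ‖fderiv ℝ g x‖ ≤ t * M := by
            gcongr
            exact hLM x hx
        _ < 1 := htM
    simpa using this
  have hinj : InjOn (fun x => x + t • g x) (closedBall (0 : E) 1) := by
    intro x hx y hy hxy
    by_contra hne
    have h1 : y - x = t • (g x - g y) := by
      simp only at hxy
      rw [smul_sub, sub_eq_sub_iff_add_eq_add]
      exact hxy.symm.trans (add_comm _ _)
    have h2 : ‖y - x‖ ≤ t * (M * ‖y - x‖) := by
      calc ‖y - x‖ = t * ‖g y - g x‖ := by
            rw [h1, norm_smul, Real.norm_of_nonneg ht0.le, norm_sub_rev]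
        _ ≤ _ := by
          gcongr
          exact hlip x hx y hy
    have h3 : 0 < ‖y - x‖ := norm_pos_iff.2 (sub_ne_zero.2 (Ne.symm hne))
    nlinarith
  have hcont : ContinuousOn (fun x => x + t • g x) (closedBall (0 : E) 1) := fun x hx =>
    (continuousAt_id.add ((hgc x hx).continuousAt.const_smul t)).continuousWithinAt
  have hmaps : ∀ x ∈ ball (0 : E) 1, x + t • g x ∈ ball (0 : E) 1 := by
    intro x hx
    have hx' := hsphere x (ball_subset_closedBall hx)
    rw [mem_ball_zero_iff] at hx ⊢
    have : x + t • g x = (1 - t) • x + t • r x := by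
      simp only [hg]
      module
    rw [this]
    calc _ ≤ ‖(1 - t) • x‖ + ‖t • r x‖ := norm_add_le _ _
      _ = (1 - t) * ‖x‖ + t := by
        rw [norm_smul, norm_smul, Real.norm_of_nonneg ht0.le,
          Real.norm_of_nonneg (by linarith), hx', mul_one]
      _ < 1 := by nlinarith
  have hopen : IsOpen ((fun x => x + t • g x) '' ball (0 : E) 1) := by
    rw [isOpen_iff_mem_nhds]
    rintro _ ⟨x, hx, rfl⟩
    have hx' := ball_subset_closedBall hx
    obtain ⟨u, hu⟩ := hdetne t ht0.le le_rfl x hx'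
    have hs : HasStrictFDerivAt (fun x => x + t • g x)
        ((ContinuousLinearEquiv.ofUnit u : E ≃L[ℝ] E) : E →L[ℝ] E) x := by
      have h1 : HasStrictFDerivAt (fun x => x + t • g x)
          (ContinuousLinearMap.id ℝ E + t • fderiv ℝ g x) x :=
        (hasStrictFDerivAt_id x).add
          (((hgc x hx').hasStrictFDerivAt (by norm_num)).const_smul t)
      convert h1 using 1
      exact hu
    rw [← hs.map_nhds_eq_of_equiv]
    exact image_mem_map (isOpen_ball.mem_nhds hx)
  refine ⟨hinj.mono ball_subset_closedBall, ?_, fun x hx => ?_⟩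
  · refine Subset.antisymm (by rintro _ ⟨x, hx, rfl⟩; exact hmaps x hx) ?_
    have h0 : (0 : E) ∈ ball (0 : E) 1 := by simp
    refine (convex_ball (0 : E) 1).isPreconnected.subset_of_closure_inter_subset hopen
      ⟨_, hmaps 0 h0, 0, h0, rfl⟩ ?_
    rintro y ⟨hy, hyb⟩
    have hcl : closure ((fun x => x + t • g x) '' ball (0 : E) 1)
        ⊆ (fun x => x + t • g x) '' closedBall (0 : E) 1 :=
      closure_minimal (image_mono ball_subset_closedBall)
        ((isCompact_closedBall (0 : E) 1).image_of_continuousOn hcont).isClosed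
    obtain ⟨x, hx, rfl⟩ := hcl hy
    refine ⟨x, ?_, rfl⟩
    rw [mem_closedBall_zero_iff] at hx
    rw [mem_ball_zero_iff]
    refine lt_of_le_of_ne hx fun h => ?_
    simp [hg, hid x h, h] at hyb
  · by_contra hneg
    push Not at hneg
    have hc : ContinuousOn (fun s : ℝ => (1 + s • fderiv ℝ g x).det) (Icc 0 t) :=
      (ContinuousLinearMap.continuous_det.comp (by fun_prop)).continuousOn
    obtain ⟨s, hs, hs0⟩ := intermediate_value_Icc' ht0.le hc
      ⟨hneg, by simp [ContinuousLinearMap.det]⟩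
    obtain ⟨u, hu⟩ := hdetne s hs.1 hs.2 x (ball_subset_closedBall hx)
    have h2 : (ContinuousLinearEquiv.ofUnit u : E ≃L[ℝ] E).toContinuousLinearMap
      = 1 + s • fderiv ℝ g x := hu
    have : IsUnit (1 + s • fderiv ℝ g x).det := by
      rw [← h2]
      exact (ContinuousLinearEquiv.ofUnit u : E ≃L[ℝ] E).toLinearEquiv.isUnit_det'
    exact this.ne_zero hs0

theorem no_contDiff_retraction_closedBall {r : E → E}
    (hr : ∀ x ∈ closedBall (0 : E) 1, ContDiffAt ℝ 1 r x)
    (hsphere : ∀ x ∈ closedBall (0 : E) 1, ‖r x‖ = 1)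
    (hid : ∀ x : E, ‖x‖ = 1 → r x = x) : False := by
  borelize E
  set g : E → E := fun x => r x - x with hg
  have hgc : ∀ x ∈ closedBall (0 : E) 1, ContDiffAt ℝ 1 g x := fun x hx =>
    (hr x hx).sub contDiffAt_id
  have hder : ContinuousOn (fderiv ℝ g) (closedBall 0 1) := fun x hx =>
    ((hgc x hx).fderiv_right (m := 0) (by norm_num)).continuousAt.continuousWithinAt
  have hint : ∀ t : ℝ, IntegrableOn (fun x => (1 + t • fderiv ℝ g x).det) (ball (0 : E) 1)
      volume := fun t =>
    (ContinuousOn.integrableOn_compact (isCompact_closedBall (0 : E) 1)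
      (ContinuousLinearMap.continuous_det.comp_continuousOn
        (by fun_prop))).mono_set ball_subset_closedBall
  obtain ⟨p, hp⟩ := exists_polynomial_setIntegral_det volume (ball (0 : E) 1) (fderiv ℝ g) hint
  obtain ⟨δ, hδ, h⟩ := exists_surjOn_perturbation hr hsphere hid
  have hvol : ∀ t : ℝ, t ∈ Ioo 0 δ → p.eval t = volume.real (ball (0 : E) 1) := by
    rintro t ⟨ht0, ht⟩
    obtain ⟨hinj, himg, hpos⟩ := h t ht0 ht
    rw [hp]
    have hd : ∀ x ∈ ball (0 : E) 1, HasFDerivWithinAt (fun x => x + t • g x)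
        (1 + t • fderiv ℝ g x) (ball 0 1) x := fun x hx =>
      ((hasFDerivAt_id x).add ((((hgc x (ball_subset_closedBall hx)).differentiableAt
        (by norm_num)).hasFDerivAt).const_smul t)).hasFDerivWithinAt
    have := integral_image_eq_integral_abs_det_fderiv_smul volume measurableSet_ball hd hinj
      (fun _ => (1 : ℝ))
    rw [himg] at this
    simp only [integral_const, smul_eq_mul, mul_one, measureReal_restrict_apply_univ] at this
    rw [this]
    refine setIntegral_congr_fun measurableSet_ball fun x hx => ?_
    exact (abs_of_pos (hpos x hx)).symm
  have hconst : p = Polynomial.C (volume.real (ball (0 : E) 1)) := by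
    refine Polynomial.eq_of_infinite_eval_eq _ _ ((Ioo_infinite hδ).mono fun t ht => ?_)
    simpa using hvol t ht
  have h1 : p.eval 1 = 0 := by
    rw [hp]
    refine setIntegral_eq_zero_of_forall_eq_zero fun x hx => ?_
    have hx' := ball_subset_closedBall hx
    have hrd : (1 + (1 : ℝ) • fderiv ℝ g x) = fderiv ℝ r x := by
      have hrx := (hr x hx').differentiableAt (by norm_num)
      have := hrx.hasFDerivAt.fun_sub (hasFDerivAt_id x)
      rw [show fderiv ℝ g x = _ from this.fderiv, one_smul]
      exact add_sub_cancel _ _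
    rw [hrd]
    by_contra hne
    have hsurj : (fderiv ℝ r x).range = ⊤ := by
      rw [← LinearMap.ker_eq_bot_iff_range_eq_top]
      by_contra hker
      exact hne (LinearMap.det_eq_zero_iff_ker_ne_bot.2 hker)
    have hmap := ((hr x hx').hasStrictFDerivAt (by norm_num)).map_nhds_eq_of_surj hsurj
    have hmem : sphere (0 : E) 1 ∈ 𝓝 (r x) := by
      rw [← hmap]
      refine mem_map.2 ?_
      filter_upwards [isOpen_ball.mem_nhds hx] with y hy
      simpa using hsphere y (ball_subset_closedBall hy)
    have := mem_interior_iff_mem_nhds.2 hmem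
    rw [interior_sphere _ one_ne_zero] at this
    exact this
  rw [hconst, Polynomial.eval_C] at h1
  have : 0 < volume.real (ball (0 : E) 1) :=
    ENNReal.toReal_pos (measure_ball_pos _ _ one_pos).ne' measure_ball_lt_top.ne
  linarith

end NoRetraction

section Brouwer

open Metric

variable {E : Type*} [NormedAddCommGroup E] [InnerProductSpace ℝ E] [FiniteDimensional ℝ E]

theorem exists_fixedPoint_closedBall_of_contDiff {q : E → E} (hq : ContDiff ℝ 1 q)
    (hlt : ∀ x ∈ closedBall (0 : E) 1, ‖q x‖ < 1) :
    ∃ x ∈ closedBall (0 : E) 1, q x = x := by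
  by_contra! hne
  let u : E → E := fun x => x - q x
  let D : E → ℝ := fun x => (inner ℝ x (u x)) ^ 2 + ‖u x‖ ^ 2 * (1 - ‖x‖ ^ 2)
  let c : E → ℝ := fun x => (-inner ℝ x (u x) + √(D x)) / ‖u x‖ ^ 2
  have hu : ContDiff ℝ 1 u := contDiff_id.sub hq
  have hu0 : ∀ x ∈ closedBall (0 : E) 1, 0 < ‖u x‖ ^ 2 := fun x hx =>
    pow_pos (norm_pos_iff.2 (sub_ne_zero.2 (hne x hx).symm)) 2
  have hinner : ∀ x : E, ‖x‖ = 1 → 0 < inner ℝ x (u x) := by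
    intro x hx
    have h1 := hlt x (by simp [hx])
    have h2 := real_inner_le_norm x (q x)
    have h3 : inner ℝ x (u x) = ‖x‖ ^ 2 - inner ℝ x (q x) := by
      simp [u, inner_sub_right]
    rw [h3, hx]
    rw [hx] at h2
    linarith
  have hD : ∀ x ∈ closedBall (0 : E) 1, 0 < D x := by
    intro x hx
    rcases (mem_closedBall_zero_iff.1 hx).lt_or_eq with h | h
    · have : 0 < 1 - ‖x‖ ^ 2 := by nlinarith [norm_nonneg x]
      have := mul_pos (hu0 x hx) this
      positivity
    · have := hinner x h
      simp only [D, h]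
      norm_num
      positivity
  refine no_contDiff_retraction_closedBall (r := fun x => x + c x • u x) (fun x hx => ?_)
    (fun x hx => ?_) (fun x hx => ?_)
  · have hi : ContDiff ℝ 1 fun x => inner ℝ x (u x) := contDiff_id.inner ℝ hu
    have hDc : ContDiff ℝ 1 D :=
      (hi.pow 2).add ((hu.norm_sq ℝ).mul (contDiff_const.sub (contDiff_id.norm_sq ℝ)))
    have hc : ContDiffAt ℝ 1 c x :=
      (hi.contDiffAt.neg.add (hDc.contDiffAt.sqrt (hD x hx).ne')).div
        (hu.norm_sq ℝ).contDiffAt (hu0 x hx).ne'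
    exact contDiffAt_id.add (hc.smul hu.contDiffAt)
  · have hs := Real.sq_sqrt (hD x hx).le
    have hu0' := hu0 x hx
    have hc : c x * ‖u x‖ ^ 2 = -inner ℝ x (u x) + √(D x) := div_mul_cancel₀ _ hu0'.ne'
    have h1 : ‖x + c x • u x‖ ^ 2 = ‖x‖ ^ 2 + 2 * (c x * inner ℝ x (u x))
        + c x ^ 2 * ‖u x‖ ^ 2 := by
      rw [norm_add_sq_real, inner_smul_right, norm_smul, mul_pow, Real.norm_eq_abs, sq_abs]
    have h2 : (c x * ‖u x‖ ^ 2 + inner ℝ x (u x)) ^ 2 = D x := by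
      rw [hc]
      linear_combination hs
    have h3 : ‖u x‖ ^ 2 * (‖x + c x • u x‖ ^ 2 - 1) = 0 := by
      rw [h1]
      simp only [D] at h2
      linear_combination h2
    have h4 : ‖x + c x • u x‖ ^ 2 = 1 := by
      rcases mul_eq_zero.1 h3 with h | h
      · exact absurd h hu0'.ne'
      · linarith
    exact (pow_eq_one_iff_of_nonneg (norm_nonneg _) two_ne_zero).1 h4
  · have : D x = (inner ℝ x (u x)) ^ 2 := by simp [D, hx]
    simp [c, this, Real.sqrt_sq (hinner x hx).le]

/-- **Brouwer's fixed point theorem** for bounded self-maps of a Euclidean space. -/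
theorem exists_fixedPoint_of_norm_le_one {g : E → E} (hg : Continuous g)
    (hle : ∀ x, ‖g x‖ ≤ 1) : ∃ x, g x = x := by
  have happrox : ∀ ε : ℝ, 0 < ε → ∃ x ∈ closedBall (0 : E) 1, ‖g x - x‖ ≤ 2 * ε := by
    intro ε hε
    obtain ⟨p, hp, hpg, -⟩ := hg.exists_contDiff_approx 1 (ε := fun _ => ε) continuous_const
      fun _ => hε
    have hpn : ∀ x, ‖p x‖ < 1 + ε := fun x => by
      have h1 := hpg x
      rw [dist_eq_norm] at h1
      have h2 := norm_add_le (g x) (p x - g x)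
      rw [add_sub_cancel] at h2
      linarith [hle x]
    have h1ε : 0 < 1 + ε := by positivity
    obtain ⟨x, hx, hxp⟩ := exists_fixedPoint_closedBall_of_contDiff (q := fun x => (1 + ε)⁻¹ • p x)
      (hp.const_smul _) fun x _ => by
        rw [norm_smul, Real.norm_of_nonneg (by positivity), inv_mul_lt_one₀ h1ε]
        exact hpn x
    refine ⟨x, hx, ?_⟩
    have hpx : p x = (1 + ε) • x := by
      rw [← hxp, smul_smul, mul_inv_cancel₀ h1ε.ne', one_smul, hxp]
    have h1 := hpg x
    rw [dist_eq_norm, norm_sub_rev] at h1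
    have h2 : g x - x = (g x - p x) + ε • x := by
      rw [hpx]; module
    rw [h2]
    rw [mem_closedBall_zero_iff] at hx
    calc _ ≤ ‖g x - p x‖ + ‖ε • x‖ := norm_add_le _ _
      _ ≤ ε + ε * 1 := by
        rw [norm_smul, Real.norm_of_nonneg hε.le]
        gcongr
      _ = 2 * ε := by ring
  obtain ⟨x, -, hmin⟩ := (isCompact_closedBall (0 : E) 1).exists_isMinOn
    ⟨0, by simp⟩ (f := fun x => ‖g x - x‖) (by fun_prop)
  refine ⟨x, sub_eq_zero.1 (norm_le_zero_iff.1 (le_of_forall_pos_le_add fun ε hε => ?_))⟩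
  obtain ⟨y, hy, hyε⟩ := happrox (ε / 2) (by positivity)
  have : ‖g x - x‖ ≤ ‖g y - y‖ := hmin hy
  linarith

theorem exists_fixedPoint_of_isBounded_range {ι : Type*} [Fintype ι]
    {g : (ι → ℝ) → ι → ℝ} (hg : Continuous g) (hb : Bornology.IsBounded (range g)) :
    ∃ x, g x = x := by
  let e := EuclideanSpace.equiv ι ℝ
  have hb' : Bornology.IsBounded (e.symm '' range g) :=
    e.symm.lipschitz.isBounded_image hb
  obtain ⟨R, hR, hRb⟩ := hb'.exists_pos_norm_le
  obtain ⟨x, hx⟩ := exists_fixedPoint_of_norm_le_one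
    (g := fun x => R⁻¹ • e.symm (g (e (R • x)))) (by fun_prop) fun x => by
      rw [norm_smul, norm_inv, Real.norm_of_nonneg hR.le, inv_mul_le_one₀ hR]
      exact hRb _ ⟨_, ⟨_, rfl⟩, rfl⟩
  refine ⟨e (R • x), ?_⟩
  apply e.symm.injective
  have h := congrArg (R • ·) hx
  simp only [smul_smul, mul_inv_cancel₀ hR.ne', one_smul] at h
  rw [h, e.symm_apply_apply]

end Brouwer

section RelativeInterior

variable {V : Type*} [NormedAddCommGroup V] [NormedSpace ℝ V] [FiniteDimensional ℝ V]

theorem Convex.exists_relative_ball_subset {s : Set V} (hs : Convex ℝ s) (hne : s.Nonempty) :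
    ∃ p ∈ s, ∃ r : ℝ, 0 < r ∧ ∀ y ∈ affineSpan ℝ s, dist y p < r → y ∈ s := by
  obtain ⟨p, hp⟩ := hne.intrinsicInterior hs
  obtain ⟨p', hp', rfl⟩ := mem_intrinsicInterior.1 hp
  obtain ⟨r, hr, hball⟩ := Metric.mem_nhds_iff.1 (mem_interior_iff_mem_nhds.1 hp')
  refine ⟨p', intrinsicInterior_subset hp, r, hr, fun y hy hyp => ?_⟩
  exact @hball ⟨y, hy⟩ hyp

theorem Convex.combo_mem_of_relative_ball_subset {s : Set V} (hs : Convex ℝ s) {p z : V} {r t : ℝ}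
    (hps : p ∈ s) (hr : 0 < r) (hp : ∀ y ∈ affineSpan ℝ s, dist y p < r → y ∈ s)
    (hz : z ∈ closure s) (ht0 : 0 < t) (ht1 : t ≤ 1) : t • p + (1 - t) • z ∈ s := by
  have hza : z ∈ affineSpan ℝ s :=
    closure_minimal (subset_affineSpan ℝ s)
      (AffineSubspace.closed_of_finiteDimensional _) hz
  obtain ⟨z', hz', hd⟩ := Metric.mem_closure_iff.1 hz (t * r) (by positivity)
  have hp's : p + ((1 - t) / t) • (z - z') ∈ s := by
    refine hp _ ?_ ?_
    · rw [add_comm]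
      exact AffineSubspace.vadd_mem_of_mem_direction
        (Submodule.smul_mem _ _ (AffineSubspace.vsub_mem_direction hza
          (subset_affineSpan ℝ s hz'))) (subset_affineSpan ℝ s hps)
    · rw [dist_eq_norm, add_sub_cancel_left, norm_smul,
        Real.norm_of_nonneg (div_nonneg (by linarith) ht0.le), ← dist_eq_norm,
        div_mul_eq_mul_div, div_lt_iff₀ ht0]
      nlinarith [dist_nonneg (x := z) (y := z')]
  have h := hs hp's hz' ht0.le (by linarith : 0 ≤ 1 - t) (by ring)
  convert h using 1
  rw [smul_add, smul_smul, mul_div_cancel₀ _ ht0.ne']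
  module

end RelativeInterior

section Selection

variable {E : Type*} [NormedAddCommGroup E] [NormedSpace ℝ E]

theorem Convex.inv_smul_mem_of_hasSum {ι : Type*} {s : Set E} (hs : Convex ℝ s)
    (hsc : IsClosed s) {w : ι → ℝ} {y : ι → E} {W : ℝ} {v : E} (hw : ∀ i, 0 ≤ w i)
    (hW : 0 < W) (hwW : HasSum w W) (hy : ∀ i, y i ∈ s)
    (hv : HasSum (fun i => w i • y i) v) : W⁻¹ • v ∈ s := by
  have h : Tendsto (fun F : Finset ι => F.centerMass w y) atTop (𝓝 (W⁻¹ • v)) :=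
    Tendsto.smul (Tendsto.inv₀ hwW hW.ne') hv
  have hpos : ∀ᶠ F : Finset ι in atTop, 0 < ∑ i ∈ F, w i := hwW.eventually (lt_mem_nhds hW)
  exact hsc.mem_of_tendsto h
    (hpos.mono fun F hF => hs.centerMass_mem (fun i _ => hw i) hF fun i _ => hy i)

theorem Convex.mem_of_hasSum_of_relative_ball_subset [FiniteDimensional ℝ E] {ι : Type*}
    {s : Set E} (hs : Convex ℝ s) {w : ι → ℝ} {y : ι → E} {v : E} {k : ι} {r : ℝ}
    (hw : ∀ i, 0 < w i) (hw1 : HasSum w 1) (hk : w k < 1) (hy : ∀ i, y i ∈ closure s)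
    (hys : y k ∈ s) (hr : 0 < r) (hk' : ∀ z ∈ affineSpan ℝ s, dist z (y k) < r → z ∈ s)
    (hv : HasSum (fun i => w i • y i) v) : v ∈ s := by
  classical
  have h1 : HasSum (Function.update w k 0) (1 - w k) := by
    simpa [add_comm, sub_eq_add_neg] using hw1.update k 0
  have h2 : HasSum (fun i => Function.update w k 0 i • y i) (v - w k • y k) := by
    convert hv.update k 0 using 1
    · funext i
      by_cases h : i = k
      · subst h; simp
      · simp [h]
    · module
  have hz := hs.closure.inv_smul_mem_of_hasSum isClosed_closure (fun i => by
      by_cases h : i = k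
      · subst h; simp
      · simpa [h] using (hw i).le) (sub_pos.2 hk) h1 hy h2
  have h3 := hs.combo_mem_of_relative_ball_subset hys hr hk' hz (hw k) hk.le
  rw [smul_smul, mul_inv_cancel₀ (sub_pos.2 hk).ne', one_smul, add_sub_cancel] at h3
  exact h3

theorem LscAt.mono_of_eventually {X Y : Type*} [TopologicalSpace X] [TopologicalSpace Y]
    {Φ Ψ : X → Set Y} {x : X} (h : LscAt Φ x) (hx : Ψ x ⊆ Φ x)
    (hΦ : ∀ᶠ x' in 𝓝 x, Φ x' ⊆ Ψ x') : LscAt Ψ x := by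
  intro Ω hΩ hne
  filter_upwards [h Ω hΩ (hne.mono (inter_subset_inter_left _ hx)), hΦ] with x' h1 h2
  exact h1.mono (inter_subset_inter_left _ h2)

theorem LscAt.inter_isOpen {X Y : Type*} [TopologicalSpace X] [TopologicalSpace Y]
    {Φ : X → Set Y} {x : X} (h : LscAt Φ x) {B : Set Y} (hB : IsOpen B) :
    LscAt (fun x => Φ x ∩ B) x := by
  intro Ω hΩ hne
  simp only [inter_assoc] at hne ⊢
  exact h _ (hB.inter hΩ) hne

theorem LscAt.inter_ball {X Y : Type*} [TopologicalSpace X] [PseudoMetricSpace Y]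
    {Φ : X → Set Y} {x : X} (h : LscAt Φ x) {g : X → Y} (hg : ContinuousAt g x) (δ : ℝ) :
    LscAt (fun x => Φ x ∩ Metric.ball (g x) δ) x := by
  rintro Ω hΩ ⟨y, ⟨hy, hyb⟩, hyΩ⟩
  rw [Metric.mem_ball] at hyb
  have hη : 0 < (δ - dist y (g x)) / 2 := by linarith
  filter_upwards [h _ (hΩ.inter Metric.isOpen_ball) ⟨y, hy, hyΩ, Metric.mem_ball_self hη⟩,
    hg.eventually (Metric.ball_mem_nhds _ hη)] with x' h1 h2
  obtain ⟨z, hz, hzΩ, hzb⟩ := h1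
  refine ⟨z, ⟨hz, ?_⟩, hzΩ⟩
  rw [Metric.mem_ball] at *
  have := dist_triangle4 z y (g x) (g x')
  rw [dist_comm (g x)] at this
  linarith

theorem exists_continuousMap_mem_thickening {X : Type*} [TopologicalSpace X] [NormalSpace X]
    [ParacompactSpace X] {Φ : X → Set E} (hΦ : ∀ x, LscAt Φ x) (hconv : ∀ x, Convex ℝ (Φ x))
    (hne : ∀ x, (Φ x).Nonempty) {ε : ℝ} (hε : 0 < ε) :
    ∃ g : C(X, E), ∀ x, g x ∈ Metric.thickening ε (Φ x) := by
  refine exists_continuous_forall_mem_convex_of_local_const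
    (fun x => (hconv x).thickening ε) fun x => ?_
  obtain ⟨c, hc⟩ := hne x
  refine ⟨c, ?_⟩
  filter_upwards [hΦ x _ Metric.isOpen_ball ⟨c, hc, Metric.mem_ball_self hε⟩] with x' hx'
  obtain ⟨z, hz, hzc⟩ := hx'
  exact Metric.mem_thickening_iff.2 ⟨z, hz, by rwa [dist_comm]⟩

/-- **Michael's selection theorem** for lower semicontinuous maps with convex values. -/
theorem exists_continuousMap_mem_closure [CompleteSpace E] {X : Type*} [TopologicalSpace X]
    [NormalSpace X] [ParacompactSpace X] {Φ : X → Set E} (hΦ : ∀ x, LscAt Φ x)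
    (hconv : ∀ x, Convex ℝ (Φ x)) (hne : ∀ x, (Φ x).Nonempty) :
    ∃ g : C(X, E), ∀ x, g x ∈ closure (Φ x) := by
  have step : ∀ (δ : ℝ) (g : C(X, E)), ∃ g' : C(X, E), 0 < δ →
      (∀ x, g x ∈ Metric.thickening δ (Φ x)) →
      (∀ x, g' x ∈ Metric.thickening (δ / 2) (Φ x)) ∧ ∀ x, dist (g x) (g' x) ≤ 2 * δ := by
    intro δ g
    by_cases h : 0 < δ ∧ ∀ x, g x ∈ Metric.thickening δ (Φ x)
    · obtain ⟨hδ, hg⟩ := h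
      obtain ⟨g', hg'⟩ := exists_continuousMap_mem_thickening (ε := δ / 2)
        (Φ := fun x => Φ x ∩ Metric.ball (g x) δ)
        (fun x => (hΦ x).inter_ball g.continuous.continuousAt δ)
        (fun x => (hconv x).inter (convex_ball _ _)) (fun x => by
          obtain ⟨z, hz, hzd⟩ := Metric.mem_thickening_iff.1 (hg x)
          exact ⟨z, hz, by rwa [Metric.mem_ball, dist_comm]⟩) (by positivity)
      refine ⟨g', fun _ _ => ⟨fun x => Metric.thickening_subset_of_subset _ inter_subset_left (hg' x),
        fun x => ?_⟩⟩
      obtain ⟨z, ⟨-, hz⟩, hzd⟩ := Metric.mem_thickening_iff.1 (hg' x)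
      rw [Metric.mem_ball] at hz
      have := dist_triangle_left (g x) (g' x) z
      rw [dist_comm] at hzd
      linarith
    · exact ⟨g, fun h1 h2 => absurd ⟨h1, h2⟩ h⟩
  choose S hS using step
  obtain ⟨g₀, hg₀⟩ := exists_continuousMap_mem_thickening hΦ hconv hne one_pos
  let G : ℕ → C(X, E) := fun n => Nat.rec g₀ (fun n g => S ((1 / 2) ^ n) g) n
  have hG : ∀ n x, G n x ∈ Metric.thickening ((1 / 2) ^ n) (Φ x) := by
    intro n
    induction n with
    | zero => rw [pow_zero]; exact hg₀
    | succ n ih =>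
      have := (hS _ _ (by positivity) ih).1
      intro x
      rw [pow_succ, mul_one_div]
      exact this x
  have hdist : ∀ x n, dist (G n x) (G (n + 1) x) ≤ 2 * (1 / 2) ^ n := fun x n =>
    (hS _ _ (by positivity) (hG n)).2 x
  have hlim : ∀ x, ∃ l, Tendsto (fun n => G n x) atTop (𝓝 l) := fun x =>
    cauchySeq_tendsto_of_complete
      (cauchySeq_of_le_geometric _ _ one_half_lt_one (hdist x))
  choose l hl using hlim
  have hbound : ∀ x n, dist (G n x) (l x) ≤ 2 * (1 / 2) ^ n / (1 - 1 / 2) := fun x n =>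
    dist_le_of_le_geometric_of_tendsto _ _ one_half_lt_one (hdist x) (hl x) n
  have hto : Tendsto (fun n : ℕ => 2 * (1 / 2 : ℝ) ^ n / (1 - 1 / 2)) atTop (𝓝 0) := by
    simpa using ((tendsto_pow_atTop_nhds_zero_of_lt_one (by norm_num)
      (one_half_lt_one (α := ℝ))).const_mul 2).div_const (1 - 1 / 2)
  have hunif : TendstoUniformly (fun n x => G n x) l atTop := by
    rw [Metric.tendstoUniformly_iff]
    intro ε hε
    filter_upwards [hto.eventually (gt_mem_nhds hε)] with n hn x
    rw [dist_comm]
    exact (hbound x n).trans_lt hn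
  refine ⟨⟨l, hunif.continuous (Frequently.of_forall fun n => (G n).continuous)⟩, fun x => ?_⟩
  rw [Metric.mem_closure_iff_infDist_zero (hne x)]
  have h1 : ∀ n, Metric.infDist (G n x) (Φ x) ≤ (1 / 2) ^ n := fun n => by
    obtain ⟨z, hz, hzd⟩ := Metric.mem_thickening_iff.1 (hG n x)
    exact (Metric.infDist_le_dist_of_mem hz).trans hzd.le
  have h2 : Tendsto (fun n => Metric.infDist (G n x) (Φ x)) atTop
      (𝓝 (Metric.infDist (l x) (Φ x))) :=
    (Metric.continuous_infDist_pt _).continuousAt.tendsto.comp (hl x)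
  exact le_antisymm (le_of_tendsto_of_tendsto' h2
    (tendsto_pow_atTop_nhds_zero_of_lt_one (by norm_num) one_half_lt_one) h1)
    Metric.infDist_nonneg

/-- A selection theorem of Michael: the values of `Φ` need not be closed. -/
theorem exists_continuousMap_mem [FiniteDimensional ℝ E] {X : Type*} [MetricSpace X]
    {Φ : X → Set E} (hΦ : ∀ x, LscAt Φ x) (hconv : ∀ x, Convex ℝ (Φ x))
    (hne : ∀ x, (Φ x).Nonempty) {S : Set E} (hS : Bornology.IsBounded S) (hΦS : ∀ x, Φ x ⊆ S) :
    ∃ g : C(X, E), ∀ x, g x ∈ Φ x := by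
  classical
  have : CompleteSpace E := FiniteDimensional.complete ℝ E
  have : ProperSpace E := FiniteDimensional.proper ℝ E
  let B : ℕ → ℕ → Set E := fun j m => Metric.ball (TopologicalSpace.denseSeq E j) (1 / (m + 1))
  have hU : ∀ j m, IsOpen {x | (Φ x ∩ B j m).Nonempty} := fun j m =>
    isOpen_iff_mem_nhds.2 fun x hx => hΦ x _ Metric.isOpen_ball hx
  choose A hAclosed hAsub hAunion _ using fun j m => (hU j m).exists_iUnion_isClosed
  let Ψ : ℕ × ℕ × ℕ → X → Set E := fun k x =>
    if x ∈ A k.1 k.2.1 k.2.2 then Φ x ∩ B k.1 k.2.1 else Φ x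
  have hΨΦ : ∀ k x, Ψ k x ⊆ Φ x := fun k x => by
    simp only [Ψ]
    split_ifs
    · exact inter_subset_left
    · exact subset_rfl
  have hΨ' : ∀ k x, Φ x ∩ B k.1 k.2.1 ⊆ Ψ k x := fun k x => by
    simp only [Ψ]
    split_ifs
    · exact subset_rfl
    · exact inter_subset_left
  have hsel : ∀ k, ∃ g : C(X, E), ∀ x, g x ∈ closure (Ψ k x) := by
    intro k
    refine exists_continuousMap_mem_closure (fun x => ?_) (fun x => ?_) (fun x => ?_)
    · by_cases hx : x ∈ A k.1 k.2.1 k.2.2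
      · refine ((hΦ x).inter_isOpen (Metric.isOpen_ball)).mono_of_eventually ?_
          (Eventually.of_forall (hΨ' k))
        simp only [Ψ, if_pos hx]
        exact subset_rfl
      · refine (hΦ x).mono_of_eventually (hΨΦ k x) ?_
        filter_upwards [(hAclosed _ _ _).isOpen_compl.mem_nhds hx] with x' hx'
        simp only [Ψ, if_neg hx']
        exact subset_rfl
    · simp only [Ψ]
      split_ifs
      · exact (hconv x).inter (convex_ball _ _)
      · exact hconv x
    · simp only [Ψ]
      split_ifs with hx
      · exact hAsub _ _ _ hx
      · exact hne x
  choose g hg using hsel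
  obtain ⟨ν, hν⟩ := exists_surjective_nat (ℕ × ℕ × ℕ)
  let w : ℕ → ℝ := fun k => (1 / 2) ^ (k + 1)
  have hw : ∀ k, 0 < w k := fun k => by positivity
  have hw1 : HasSum w 1 := by
    convert hasSum_geometric_two' (1 : ℝ) using 1
    funext k
    simp only [w]
    rw [pow_succ, one_div_pow]
    ring
  obtain ⟨R, hR⟩ := hS.closure.exists_norm_le
  have hgΦ : ∀ k x, g k x ∈ closure (Φ x) := fun k x => closure_mono (hΨΦ k x) (hg k x)
  have hbd : ∀ k x, ‖w k • g (ν k) x‖ ≤ w k * R := fun k x => by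
    rw [norm_smul, Real.norm_of_nonneg (hw k).le]
    exact mul_le_mul_of_nonneg_left (hR _ (closure_mono (hΦS x) (hgΦ _ x))) (hw k).le
  have hwR : Summable fun k => w k * R := hw1.summable.mul_right R
  refine ⟨⟨fun x => ∑' k, w k • g (ν k) x,
    continuous_tsum (fun k => by fun_prop) hwR hbd⟩, fun x => ?_⟩
  obtain ⟨p, hp, r, hr, hpr⟩ := (hconv x).exists_relative_ball_subset (hne x)
  obtain ⟨m, hm⟩ := exists_nat_one_div_lt (show 0 < r / 4 by positivity)
  obtain ⟨j, hj⟩ := (TopologicalSpace.denseRange_denseSeq E).exists_dist_lt p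
    (show (0 : ℝ) < 1 / (m + 1) by positivity)
  have hxU : x ∈ ⋃ i, A j m i := by
    rw [hAunion]
    exact ⟨p, hp, hj⟩
  obtain ⟨i, hi⟩ := mem_iUnion.1 hxU
  obtain ⟨k, hk⟩ := hν (j, m, i)
  have hgk : dist (g (ν k) x) p < r / 2 := by
    have h1 : g (ν k) x ∈ closure (B j m) := by
      refine closure_mono ?_ (hg (ν k) x)
      simp only [hk, Ψ, if_pos hi]
      exact inter_subset_right
    have h2 := Metric.closure_ball_subset_closedBall h1
    rw [Metric.mem_closedBall] at h2
    have := dist_triangle_right (g (ν k) x) p (TopologicalSpace.denseSeq E j)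
    linarith
  have hspan : g (ν k) x ∈ affineSpan ℝ (Φ x) :=
    closure_minimal (subset_affineSpan ℝ _)
      (AffineSubspace.closed_of_finiteDimensional _) (hgΦ _ x)
  refine (hconv x).mem_of_hasSum_of_relative_ball_subset (y := fun k => g (ν k) x) (k := k)
    (r := r / 2) hw hw1 (pow_lt_one₀ (by norm_num) (by norm_num) (Nat.succ_ne_zero k))
    (fun k => hgΦ _ x) (hpr _ hspan (by linarith)) (by positivity) (fun z hz hzd => ?_)
    (Summable.of_norm_bounded hwR fun k => hbd k x).hasSum
  refine hpr z hz ?_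
  have := dist_triangle z (g (ν k) x) p
  linarith

end Selection

section FixedPoint

theorem exists_retraction_of_convex_isCompact {E : Type*} [NormedAddCommGroup E]
    [NormedSpace ℝ E] [CompleteSpace E] {C : Set E} (hne : C.Nonempty) (hconv : Convex ℝ C)
    (hcomp : IsCompact C) : ∃ r : C(E, E), (∀ x, r x ∈ C) ∧ ∀ x ∈ C, r x = x := by
  classical
  let Φ : E → Set E := fun x => if x ∈ C then {x} else C
  have hlsc : ∀ x, LscAt Φ x := fun x => by
    by_cases hx : x ∈ C
    · intro Ω hΩ hne'
      have hxΩ : x ∈ Ω := by simpa [Φ, hx] using hne'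
      filter_upwards [hΩ.mem_nhds hxΩ] with x' hx'
      by_cases h : x' ∈ C
      · simpa [Φ, h] using hx'
      · simpa only [Φ, if_neg h] using ⟨x, hx, hxΩ⟩
    · intro Ω hΩ hne'
      filter_upwards [hcomp.isClosed.isOpen_compl.mem_nhds hx] with x' hx'
      rw [show Φ x' = C from if_neg hx']
      rwa [show Φ x = C from if_neg hx] at hne'
  have hΦconv : ∀ x, Convex ℝ (Φ x) := fun x => by
    simp only [Φ]
    split_ifs
    · exact convex_singleton x
    · exact hconv
  have hΦne : ∀ x, (Φ x).Nonempty := fun x => by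
    simp only [Φ]
    split_ifs
    · exact singleton_nonempty x
    · exact hne
  obtain ⟨r, hr⟩ := exists_continuousMap_mem_closure hlsc hΦconv hΦne
  have hfix : ∀ x ∈ C, r x = x := fun x hx => by
    have := hr x
    simpa only [Φ, if_pos hx, closure_singleton, mem_singleton_iff] using this
  refine ⟨r, fun x => ?_, hfix⟩
  by_cases hx : x ∈ C
  · rwa [hfix x hx]
  · have := hr x
    rwa [show Φ x = C from if_neg hx, hcomp.isClosed.closure_eq] at this

/-- A lower semicontinuous map with nonempty convex (not necessarily closed) values from a compact
convex set to itself has a fixed point. -/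
theorem exists_mem_of_lscAt {ι : Type*} [Fintype ι] {C : Set (ι → ℝ)} (hne : C.Nonempty)
    (hconv : Convex ℝ C) (hcomp : IsCompact C) {Φ : C → Set (ι → ℝ)} (hΦ : ∀ x, LscAt Φ x)
    (hΦconv : ∀ x, Convex ℝ (Φ x)) (hΦne : ∀ x, (Φ x).Nonempty) (hΦC : ∀ x, Φ x ⊆ C) :
    ∃ x : C, (x : ι → ℝ) ∈ Φ x := by
  obtain ⟨g, hg⟩ := exists_continuousMap_mem hΦ hΦconv hΦne hcomp.isBounded hΦC
  obtain ⟨r, hrC, hrfix⟩ := exists_retraction_of_convex_isCompact hne hconv hcomp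
  obtain ⟨z, hz⟩ := exists_fixedPoint_of_isBounded_range (g := fun x => g ⟨r x, hrC x⟩)
    (by fun_prop) (hcomp.isBounded.subset (by rintro _ ⟨x, rfl⟩; exact hΦC _ (hg _)))
  have hzC : z ∈ C := by
    rw [← hz]
    exact hΦC _ (hg _)
  refine ⟨⟨z, hzC⟩, ?_⟩
  have h := hg ⟨z, hzC⟩
  simp only [hrfix z hzC] at hz
  rwa [hz] at h

end FixedPoint

section Intersection

variable {V : Type*} [NormedAddCommGroup V] [NormedSpace ℝ V]

theorem Convex.mem_closure_of_forall_exists_dist_le {D : Set V} (hD : Convex ℝ D)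
    {A : AffineSubspace ℝ V} (hDA : D ⊆ A) {y q : V} {ρ : ℝ}
    (h : ∀ v ∈ A, dist v y ≤ ρ → ∃ d ∈ D, dist v d ≤ ρ / 2) (hqA : q ∈ A)
    (hq : dist q y ≤ ρ / 2) : q ∈ closure D := by
  have key : ∀ e ∈ A.direction, ‖e‖ ≤ ρ → ∃ e' ∈ A.direction, ‖e'‖ ≤ ρ ∧
      ∃ d ∈ D, d - q = (1 / 2 : ℝ) • e - (1 / 2 : ℝ) • e' := by
    intro e he hen
    have hvA : q + (1 / 2 : ℝ) • e ∈ A := by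
      rw [add_comm]
      exact AffineSubspace.vadd_mem_of_mem_direction (Submodule.smul_mem _ _ he) hqA
    obtain ⟨d, hd, hdv⟩ := h _ hvA (by
      have h1 : dist (q + (1 / 2 : ℝ) • e) q ≤ ρ / 2 := by
        rw [dist_eq_norm, add_sub_cancel_left, norm_smul]
        norm_num
        linarith
      linarith [dist_triangle (q + (1 / 2 : ℝ) • e) q y])
    refine ⟨(2 : ℝ) • (q + (1 / 2 : ℝ) • e - d), Submodule.smul_mem _ _
      (AffineSubspace.vsub_mem_direction hvA (hDA hd)), ?_, d, hd, by module⟩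
    rw [norm_smul, ← dist_eq_norm]
    norm_num
    linarith
  have hρ : 0 ≤ ρ := by linarith [dist_nonneg (x := q) (y := y)]
  have avg : ∀ m : ℕ, ∃ e ∈ A.direction, ‖e‖ ≤ ρ ∧ ∃ c ∈ D,
      ((m : ℝ) + 1) • (c - q) = -((1 / 2 : ℝ) • e) := by
    intro m
    induction m with
    | zero =>
      obtain ⟨e, he, hen, d, hd, hde⟩ := key 0 (Submodule.zero_mem _) (by simpa using hρ)
      exact ⟨e, he, hen, d, hd, by rw [hde]; simp⟩
    | succ m ih =>
      obtain ⟨e, he, hen, c, hc, hce⟩ := ih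
      obtain ⟨e', he', hen', d, hd, hde⟩ := key e he hen
      have hm : (0 : ℝ) < m + 2 := by positivity
      refine ⟨e', he', hen', (((m : ℝ) + 1) / (m + 2)) • c + (1 / ((m : ℝ) + 2)) • d,
        hD hc hd (by positivity) (by positivity) (by field_simp; ring), ?_⟩
      calc (((m + 1 : ℕ) : ℝ) + 1) • ((((m : ℝ) + 1) / (m + 2)) • c
            + (1 / ((m : ℝ) + 2)) • d - q) = ((m : ℝ) + 1) • (c - q) + (d - q) := by
            push_cast
            match_scalars <;> field_simp <;> ring
        _ = -((1 / 2 : ℝ) • e') := by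
            rw [hce, hde]
            abel
  refine Metric.mem_closure_iff.2 fun ε hε => ?_
  obtain ⟨m, hm⟩ := exists_nat_gt (ρ / ε)
  obtain ⟨e, -, hen, c, hc, hce⟩ := avg m
  refine ⟨c, hc, ?_⟩
  rw [div_lt_iff₀ hε] at hm
  have h1 := congrArg norm hce
  rw [norm_smul, norm_neg, norm_smul, Real.norm_of_nonneg (by positivity),
    Real.norm_of_nonneg (by norm_num)] at h1
  rw [dist_comm, dist_eq_norm]
  have hm0 : (0 : ℝ) < m + 1 := by positivity
  by_contra hcon
  push Not at hcon
  nlinarith [mul_le_mul_of_nonneg_left hcon hm0.le]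

theorem Convex.mem_of_forall_exists_dist_le [FiniteDimensional ℝ V] {D : Set V}
    (hD : Convex ℝ D) {A : AffineSubspace ℝ V} (hDA : D ⊆ A) {y q : V} {ρ : ℝ} (hyA : y ∈ A)
    (hρ : 0 < ρ) (h : ∀ v ∈ A, dist v y ≤ ρ → ∃ d ∈ D, dist v d ≤ ρ / 2) (hqA : q ∈ A)
    (hq : dist q y < ρ / 4) : q ∈ D := by
  obtain ⟨d, hd, -⟩ := h y hyA (by simpa using hρ.le)
  obtain ⟨p, hp, r, hr, hpr⟩ := hD.exists_relative_ball_subset ⟨d, hd⟩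
  obtain ⟨s, hs0, hs⟩ : ∃ s : ℝ, 0 < s ∧ s * ‖q - p‖ ≤ ρ / 4 := by
    refine ⟨ρ / 4 / (‖q - p‖ + 1), by positivity, ?_⟩
    rw [div_mul_eq_mul_div, div_le_iff₀ (by positivity)]
    nlinarith [norm_nonneg (q - p)]
  have hz : q + s • (q - p) ∈ closure D := by
    refine hD.mem_closure_of_forall_exists_dist_le hDA h ?_ ?_
    · rw [add_comm]
      exact AffineSubspace.vadd_mem_of_mem_direction (Submodule.smul_mem _ _
        (AffineSubspace.vsub_mem_direction hqA (hDA hp))) hqA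
    · have h1 : dist (q + s • (q - p)) q ≤ ρ / 4 := by
        rwa [dist_eq_norm, add_sub_cancel_left, norm_smul, Real.norm_of_nonneg hs0.le]
      linarith [dist_triangle (q + s • (q - p)) q y]
  have h1s : 0 < 1 + s := by positivity
  have := hD.combo_mem_of_relative_ball_subset hp hr hpr hz (t := s / (1 + s)) (by positivity)
    (by rw [div_le_one h1s]; linarith)
  convert this using 1
  match_scalars <;> field_simp <;> ring

theorem LscAt.inter_of_affineSpan_eq [FiniteDimensional ℝ V] {X : Type*} [TopologicalSpace X]
    {Φ Ψ : X → Set V} {x : X} {A : AffineSubspace ℝ V} (hΦ : LscAt Φ x) (hΨ : LscAt Ψ x)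
    (hconv : ∀ x', Convex ℝ (Φ x')) (hΦA : ∀ x', Φ x' ⊆ A) (hΨA : ∀ x', Ψ x' ⊆ A)
    (hspan : affineSpan ℝ (Φ x) = A) (hopen : ∀ y ∈ Ψ x, ∀ᶠ z in 𝓝[Φ x] y, z ∈ Ψ x) :
    LscAt (fun x' => Φ x' ∩ Ψ x') x := by
  have : ProperSpace V := FiniteDimensional.proper ℝ V
  rintro Ω hΩ ⟨y₀, ⟨hy₀Φ, hy₀Ψ⟩, hy₀Ω⟩
  obtain ⟨p, hp, r, hr, hpr⟩ := (hconv x).exists_relative_ball_subset ⟨y₀, hy₀Φ⟩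
  rw [hspan] at hpr
  have hIoo : ∀ᶠ t : ℝ in 𝓝[>] 0, t ∈ Ioo (0 : ℝ) 1 := Ioo_mem_nhdsGT one_pos
  have hmem : ∀ᶠ t : ℝ in 𝓝[>] 0, t • p + (1 - t) • y₀ ∈ Φ x := by
    filter_upwards [hIoo] with t ht
    exact hconv x hp hy₀Φ ht.1.le (by linarith [ht.2]) (by ring)
  have hpath : Tendsto (fun t : ℝ => t • p + (1 - t) • y₀) (𝓝[>] 0) (𝓝[Φ x] y₀) := by
    refine tendsto_nhdsWithin_iff.2 ⟨?_, hmem⟩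
    have : ContinuousAt (fun t : ℝ => t • p + (1 - t) • y₀) 0 := by fun_prop
    have h0 := this.tendsto
    simp only [zero_smul, sub_zero, one_smul, zero_add] at h0
    exact h0.mono_left nhdsWithin_le_nhds
  obtain ⟨t, ht, htΦ, htΨ, htΩ⟩ := (hIoo.and
    (hmem.and ((hpath.eventually (hopen y₀ hy₀Ψ)).and
      (hpath.eventually (mem_nhdsWithin_of_mem_nhds (hΩ.mem_nhds hy₀Ω)))))).exists
  set y : V := t • p + (1 - t) • y₀ with hy
  have hball : ∀ v ∈ A, dist v y < t * r → v ∈ Φ x := by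
    intro v hv hvy
    have hp' : p + t⁻¹ • (v - y) ∈ Φ x := by
      refine hpr _ ?_ ?_
      · rw [add_comm]
        exact AffineSubspace.vadd_mem_of_mem_direction (Submodule.smul_mem _ _
          (AffineSubspace.vsub_mem_direction hv (hΦA x htΦ))) (hΦA x hp)
      · rw [dist_eq_norm, add_sub_cancel_left, norm_smul, norm_inv,
          Real.norm_of_nonneg ht.1.le, ← dist_eq_norm, inv_mul_lt_iff₀ ht.1]
        exact hvy
    have := hconv x hp' hy₀Φ ht.1.le (by linarith [ht.2] : 0 ≤ 1 - t) (by ring)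
    rw [smul_add, smul_smul, mul_inv_cancel₀ ht.1.ne', one_smul] at this
    convert this using 1
    rw [hy]
    module
  set ρ : ℝ := t * r / 2 with hρ
  have htr : 0 < t * r := mul_pos ht.1 hr
  have hρ0 : 0 < ρ := by positivity
  have hQ : IsCompact (Metric.closedBall y ρ ∩ A) :=
    (isCompact_closedBall y ρ).inter_right (AffineSubspace.closed_of_finiteDimensional A)
  obtain ⟨T, hTQ, hTfin, hTcover⟩ := hQ.finite_cover_balls (show 0 < ρ / 4 by positivity)
  have hnear : ∀ᶠ x' in 𝓝 x, ∀ v ∈ T, (Φ x' ∩ Metric.ball v (ρ / 4)).Nonempty := by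
    refine (eventually_all_finite hTfin).2 fun v hv => hΦ _ Metric.isOpen_ball
      ⟨v, hball v (hTQ hv).2 ?_, Metric.mem_ball_self (by positivity)⟩
    have := Metric.mem_closedBall.1 (hTQ hv).1
    linarith
  filter_upwards [hnear, hΨ _ (hΩ.inter Metric.isOpen_ball)
    ⟨y, htΨ, htΩ, Metric.mem_ball_self (show 0 < ρ / 4 by positivity)⟩] with x' h1 h2
  obtain ⟨q, hqΨ, hqΩ, hqb⟩ := h2
  refine ⟨q, ⟨(hconv x').mem_of_forall_exists_dist_le (hΦA x') (hΦA x htΦ) hρ0 (fun v hv hvy => ?_)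
    (hΨA x' hqΨ) hqb, hqΨ⟩, hqΩ⟩
  obtain ⟨w, hwT, hvw⟩ := mem_iUnion₂.1 (hTcover ⟨hvy, hv⟩)
  obtain ⟨d, hd, hdw⟩ := h1 w hwT
  refine ⟨d, hd, ?_⟩
  rw [Metric.mem_ball] at hvw hdw
  linarith [dist_triangle_right v d w]

theorem LscAt.image {X Y Z : Type*} [TopologicalSpace X] [TopologicalSpace Y]
    [TopologicalSpace Z] {Φ : X → Set Y} {x : X} (hΦ : LscAt Φ x) {h : Y → Z}
    (hh : Continuous h) : LscAt (fun x => h '' Φ x) x := by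
  intro Ω hΩ hne
  simp only [← image_inter_preimage, image_nonempty] at hne ⊢
  exact hΦ _ (hΩ.preimage hh) hne

end Intersection

/-- Theorem 3.4: existence for the quasiequilibrium problem when, besides the standard
assumptions on `K` and the convexity and lower semicontinuity of `F` on `fix K`, one has
`aff (K x) = aff C` and `F x` open in the relative topology of `C` for every point `x` of
`∂_C fix K`. -/
theorem quasiequilibrium_existence_affineHull {n : ℕ} {C : Set (Fin n → ℝ)}
    (hCne : C.Nonempty) (hCconv : Convex ℝ C) (hCcomp : IsCompact C)
    (f : C → C → ℝ) (hdiag : ∀ x : C, f x x = 0)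
    (K : C → Set C)
    (hKlsc : ∀ x : C, LscAt K x)
    (hKne : ∀ x : C, (K x).Nonempty)
    (hKconv : ∀ x : C, Convex ℝ (Subtype.val '' K x))
    (hfix : IsClosed {x : C | x ∈ K x})
    (F : C → Set C) (hF : ∀ x : C, F x = {y : C | f x y < 0})
    (hFconv : ∀ x ∈ {x : C | x ∈ K x}, Convex ℝ (Subtype.val '' F x))
    (hFlsc : ∀ x ∈ {x : C | x ∈ K x}, LscAt F x)
    (hKaff : ∀ x ∈ frontier {x : C | x ∈ K x},
      affineSpan ℝ (Subtype.val '' K x) = affineSpan ℝ C)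
    (hFopen : ∀ x ∈ frontier {x : C | x ∈ K x}, IsOpen (F x)) :
    ∃ x : C, x ∈ K x ∧ ∀ y ∈ K x, 0 ≤ f x y := by
  classical
  by_contra! hno
  set S : Set C := {x | x ∈ K x} with hS
  have hxF : ∀ x, x ∉ F x := fun x hx => by
    rw [hF] at hx
    exact (hdiag x).not_lt hx
  have hsubC : ∀ T : Set C, Subtype.val '' T ⊆ C := fun T => by
    rintro _ ⟨y, -, rfl⟩
    exact y.2
  have hne : ∀ x ∈ S, (Subtype.val '' K x ∩ Subtype.val '' F x).Nonempty := fun x hx => by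
    obtain ⟨y, hyK, hy⟩ := hno x hx
    exact ⟨y, mem_image_of_mem _ hyK, mem_image_of_mem _ (by rw [hF]; exact hy)⟩
  let G : C → Set (Fin n → ℝ) := fun x =>
    if x ∈ interior S then Subtype.val '' F x
    else if x ∈ S then Subtype.val '' K x ∩ Subtype.val '' F x
    else Subtype.val '' K x
  have hinterG : ∀ x, Subtype.val '' K x ∩ Subtype.val '' F x ⊆ G x := fun x => by
    simp only [G]
    split_ifs
    · exact inter_subset_right
    · exact subset_rfl
    · exact inter_subset_left
  have hGlsc : ∀ x, LscAt G x := fun x => by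
    by_cases hint : x ∈ interior S
    · refine ((hFlsc x (interior_subset hint)).image continuous_subtype_val).mono_of_eventually
        ?_ ?_
      · simp only [G, if_pos hint]
        exact subset_rfl
      · filter_upwards [isOpen_interior.mem_nhds hint] with x' hx'
        simp only [G, if_pos hx']
        exact subset_rfl
    · by_cases hxS : x ∈ S
      · have hfr : x ∈ frontier S := ⟨subset_closure hxS, hint⟩
        refine LscAt.mono_of_eventually (Φ := fun x => Subtype.val '' K x ∩ Subtype.val '' F x)
          (((hKlsc x).image continuous_subtype_val).inter_of_affineSpan_eq
            ((hFlsc x hxS).image continuous_subtype_val) hKconv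
            (fun x' => (hsubC _).trans (subset_affineSpan ℝ C))
            (fun x' => (hsubC _).trans (subset_affineSpan ℝ C)) (hKaff x hfr) ?_) ?_
          (Eventually.of_forall hinterG)
        · rintro _ ⟨y, hy, rfl⟩
          obtain ⟨O, hO, hOF⟩ := isOpen_induced_iff.1 (hFopen x hfr)
          have hyO : (y : Fin n → ℝ) ∈ O := by
            rw [← hOF] at hy
            exact hy
          filter_upwards [self_mem_nhdsWithin, mem_nhdsWithin_of_mem_nhds (hO.mem_nhds hyO)]
            with z hzK hzO
          obtain ⟨z, -, rfl⟩ := hzK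
          refine mem_image_of_mem _ ?_
          rw [← hOF]
          exact hzO
        · simp only [G, if_neg hint, if_pos hxS]
          exact subset_rfl
      · refine ((hKlsc x).image continuous_subtype_val).mono_of_eventually ?_ ?_
        · simp only [G, if_neg hint, if_neg hxS]
          exact subset_rfl
        · filter_upwards [hfix.isOpen_compl.mem_nhds hxS] with x' hx'
          simp only [G, if_neg (fun h => hx' (interior_subset h)), if_neg hx']
          exact subset_rfl
  have hGconv : ∀ x, Convex ℝ (G x) := fun x => by
    simp only [G]
    split_ifs with h1 h2
    · exact hFconv x (interior_subset h1)
    · exact (hKconv x).inter (hFconv x h2)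
    · exact hKconv x
  have hGne : ∀ x, (G x).Nonempty := fun x => by
    simp only [G]
    split_ifs with h1 h2
    · exact (hne x (interior_subset h1)).mono inter_subset_right
    · exact hne x h2
    · exact (hKne x).image _
  have hGC : ∀ x, G x ⊆ C := fun x => by
    simp only [G]
    split_ifs
    · exact hsubC _
    · exact inter_subset_left.trans (hsubC _)
    · exact hsubC _
  obtain ⟨x, hx⟩ := exists_mem_of_lscAt hCne hCconv hCcomp hGlsc hGconv hGne hGC
  simp only [G] at hx
  split_ifs at hx with h1 h2
  · exact hxF x (Subtype.val_injective.mem_set_image.1 hx)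
  · exact hxF x (Subtype.val_injective.mem_set_image.1 hx.2)
  · have hxK : x ∈ K x := Subtype.val_injective.mem_set_image.1 hx
    exact h2 hxK
end

section
/- Let C := {(x,y) ∈ ℝ² : x² + y² ≤ 1} be the closed unit ball of ℝ² and define Φ : [0,1] ⇉ C by Φ(t) := C \ {(cos t, sin t)} for t > 0 and Φ(0) := C. Then Φ has open lower sections (for every y ∈ C the set Φ⁻¹(y) := {t ∈ [0,1] : y ∈ Φ(t)} is open in [0,1]) and every value Φ(t) is convex and open in the relative topology of C, but the graph gph Φ := {(t,y) ∈ [0,1] × C : y ∈ Φ(t)} is NOT open in [0,1] × C. -/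
open Set Topology Filter

/-- A point of the closed unit disc other than the unit vector `(c, s)` has inner product
less than `1` with it. -/
lemma mul_add_mul_lt_one_of_ne {p : ℝ × ℝ} {c s : ℝ} (hp : p.1 ^ 2 + p.2 ^ 2 ≤ 1)
    (hcs : c ^ 2 + s ^ 2 = 1) (hne : p ≠ (c, s)) : p.1 * c + p.2 * s < 1 := by
  by_contra! h
  have h1 : (p.1 - c) ^ 2 = 0 := by nlinarith [sq_nonneg (p.1 - c), sq_nonneg (p.2 - s)]
  have h2 : (p.2 - s) ^ 2 = 0 := by nlinarith [sq_nonneg (p.1 - c), sq_nonneg (p.2 - s)]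
  exact hne (Prod.ext (sub_eq_zero.mp (pow_eq_zero_iff two_ne_zero |>.mp h1))
    (sub_eq_zero.mp (pow_eq_zero_iff two_ne_zero |>.mp h2)))

lemma convex_unit_disc : Convex ℝ {p : ℝ × ℝ | p.1 ^ 2 + p.2 ^ 2 ≤ 1} := by
  have h : ConvexOn ℝ univ fun x : ℝ => x ^ 2 := even_two.convexOn_pow
  have h1 : ConvexOn ℝ univ fun p : ℝ × ℝ => p.1 ^ 2 := h.comp_linearMap (LinearMap.fst ℝ ℝ ℝ)
  have h2 : ConvexOn ℝ univ fun p : ℝ × ℝ => p.2 ^ 2 := h.comp_linearMap (LinearMap.snd ℝ ℝ ℝ)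
  simpa using (h1.add h2).convex_le 1

/-- Removing a boundary point from the closed unit disc leaves a convex set. -/
lemma convex_unit_disc_diff_singleton {c s : ℝ} (hcs : c ^ 2 + s ^ 2 = 1) :
    Convex ℝ ({p : ℝ × ℝ | p.1 ^ 2 + p.2 ^ 2 ≤ 1} \ {(c, s)}) := by
  rintro x ⟨hx, hxe⟩ y ⟨hy, hye⟩ a b ha hb hab
  refine ⟨convex_unit_disc hx hy ha hb hab, fun he => ?_⟩
  have h1 := mul_add_mul_lt_one_of_ne hx hcs hxe
  have h2 := mul_add_mul_lt_one_of_ne hy hcs hye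
  obtain ⟨e1, e2⟩ := Prod.ext_iff.mp (mem_singleton_iff.mp he)
  simp only [Prod.fst_add, Prod.snd_add, Prod.smul_fst, Prod.smul_snd, smul_eq_mul] at e1 e2
  have h3 : a * (x.1 * c + x.2 * s) + b * (y.1 * c + y.2 * s) = 1 := by
    rw [← hcs]
    linear_combination c * e1 + s * e2
  rcases ha.eq_or_lt with rfl | ha
  · obtain rfl : b = 1 := by linarith
    linarith
  · nlinarith [mul_lt_mul_of_pos_left h1 ha, mul_le_mul_of_nonneg_left h2.le hb]

/-- Example 3.2: on the closed unit ball `C` of `ℝ²`, the map `Φ : [0,1] ⇉ C` with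
`Φ 0 = C` and `Φ t = C \ {(cos t, sin t)}` for `t > 0` has open lower sections and convex
open values in `C`, yet its graph is not open in `[0,1] × C`. -/
theorem example_graph_not_open
    (C : Set (ℝ × ℝ)) (hC : C = {p : ℝ × ℝ | p.1 ^ 2 + p.2 ^ 2 ≤ 1})
    (Φ : Set.Icc (0 : ℝ) 1 → Set C)
    (hΦ0 : ∀ t : Set.Icc (0 : ℝ) 1, (t : ℝ) = 0 → Φ t = Set.univ)
    (hΦpos : ∀ t : Set.Icc (0 : ℝ) 1, 0 < (t : ℝ) →
      Φ t = {y : C | (y : ℝ × ℝ) ≠ (Real.cos (t : ℝ), Real.sin (t : ℝ))}) :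
    (∀ y : C, IsOpen {t : Set.Icc (0 : ℝ) 1 | y ∈ Φ t}) ∧
    (∀ t : Set.Icc (0 : ℝ) 1, Convex ℝ (Subtype.val '' Φ t)) ∧
    (∀ t : Set.Icc (0 : ℝ) 1, IsOpen (Φ t)) ∧
    ¬ IsOpen {p : Set.Icc (0 : ℝ) 1 × C | p.2 ∈ Φ p.1} := by
  subst hC
  have key : ∀ t : Icc (0 : ℝ) 1, (t : ℝ) = 0 ∨ 0 < (t : ℝ) := fun t =>
    t.2.1.eq_or_lt.imp_left Eq.symm
  refine ⟨fun y => ?_, fun t => ?_, fun t => ?_, fun hopen => ?_⟩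
  · have hsub : {t : Icc (0 : ℝ) 1 | y ∈ Φ t}ᶜ.Subsingleton := by
      have hmem : ∀ t : Icc (0 : ℝ) 1, y ∉ Φ t →
          (y : ℝ × ℝ) = (Real.cos (t : ℝ), Real.sin (t : ℝ)) := by
        intro t ht
        rcases key t with h | h
        · simp [hΦ0 t h] at ht
        · simpa [hΦpos t h] using ht
      intro t ht u hu
      have hcos := congrArg Prod.fst ((hmem t ht).symm.trans (hmem u hu))
      have hpi : ∀ v : Icc (0 : ℝ) 1, (v : ℝ) ∈ Icc 0 Real.pi := fun v =>
        ⟨v.2.1, v.2.2.trans (by linarith [Real.pi_gt_three])⟩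
      exact Subtype.ext (Real.injOn_cos (hpi t) (hpi u) hcos)
    exact isClosed_compl_iff.mp hsub.finite.isClosed
  · rcases key t with h | h
    · rw [hΦ0 t h, image_univ, Subtype.range_coe]
      exact convex_unit_disc
    · convert convex_unit_disc_diff_singleton (Real.cos_sq_add_sin_sq (t : ℝ)) using 1
      rw [hΦpos t h]
      ext p
      exact ⟨fun ⟨q, hq, hqp⟩ => hqp ▸ ⟨q.2, hq⟩, fun hp => ⟨⟨p, hp.1⟩, hp.2, rfl⟩⟩
  · rcases key t with h | h
    · rw [hΦ0 t h]
      exact isOpen_univ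
    · rw [hΦpos t h]
      exact isOpen_ne_fun continuous_subtype_val continuous_const
  · let g : Icc (0 : ℝ) 1 → Icc (0 : ℝ) 1 × {p : ℝ × ℝ | p.1 ^ 2 + p.2 ^ 2 ≤ 1} := fun t =>
      (t, ⟨(Real.cos (t : ℝ), Real.sin (t : ℝ)), (Real.cos_sq_add_sin_sq (t : ℝ)).le⟩)
    have hg : Continuous g := by
      refine continuous_id.prodMk (Continuous.subtype_mk ?_ _)
      fun_prop
    obtain ⟨ε, hε, hball⟩ := Metric.isOpen_iff.mp (hopen.preimage hg) 0
      (by simp [g, hΦ0 0 rfl])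
    have hpos : 0 < min (ε / 2) 1 := by positivity
    let t : Icc (0 : ℝ) 1 := ⟨min (ε / 2) 1, hpos.le, min_le_right _ _⟩
    have ht : t ∈ Metric.ball (0 : Icc (0 : ℝ) 1) ε := by
      rw [Metric.mem_ball, Subtype.dist_eq, Real.dist_eq]
      change |min (ε / 2) 1 - 0| < ε
      rw [sub_zero, abs_of_pos hpos]
      linarith [min_le_left (ε / 2) 1]
    have hmem : (g t).2 ∈ Φ t := hball ht
    rw [hΦpos t hpos] at hmem
    exact hmem rfl
end
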